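/- arXiv:math/0501196 — 2 statements merged into one kernel-verified Lean document; each statement's English description precedes it below -/
import Mathlib

section
/- Let a, b be nonzero complex numbers with |a| < 1. The family 𝓕_{a,b} of all injective holomorphic functions f : D → ℂ on the open unit disc D with f(0) = 0 and f(a) = b is a normal family: every sequence in 𝓕_{a,b} has a subsequence converging uniformly on compact subsets of D to a holomorphic function. -/
open Metric Set Filter Topology

section InjectiveHolomorphic

variable {U : Set ℂ} {f : ℂ → ℂ}

theorem Set.InjOn.not_eventually_const {z : ℂ} (hU : IsOpen U) (hinj : InjOn f U) (hz : z ∈ U) :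
    ¬ ∀ᶠ w in 𝓝 z, f w = f z := by
  intro h
  have hmem : ∀ᶠ w in 𝓝[≠] z, w = z := by
    filter_upwards [nhdsWithin_le_nhds h, nhdsWithin_le_nhds (hU.mem_nhds hz)] with w hw hwU
    exact hinj hwU hz hw
  obtain ⟨w, hw, hne⟩ := (hmem.and self_mem_nhdsWithin).exists
  exact hne hw

theorem DifferentiableOn.nhds_le_map_nhds_of_injOn (hf : DifferentiableOn ℂ f U) (hU : IsOpen U)
    (hinj : InjOn f U) {z : ℂ} (hz : z ∈ U) : 𝓝 (f z) ≤ map f (𝓝 z) :=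
  (hf.analyticAt (hU.mem_nhds hz)).eventually_constant_or_nhds_le_map_nhds.resolve_left
    (hinj.not_eventually_const hU hz)

theorem DifferentiableOn.isOpen_image_of_injOn (hf : DifferentiableOn ℂ f U) (hU : IsOpen U)
    (hinj : InjOn f U) : IsOpen (f '' U) := by
  rw [isOpen_iff_mem_nhds]
  rintro _ ⟨z, hz, rfl⟩
  exact hf.nhds_le_map_nhds_of_injOn hU hinj hz (image_mem_map (hU.mem_nhds hz))

theorem DifferentiableOn.continuousAt_invFunOn (hf : DifferentiableOn ℂ f U) (hU : IsOpen U)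
    (hinj : InjOn f U) {z : ℂ} (hz : z ∈ U) : ContinuousAt (Function.invFunOn f U) (f z) := by
  rw [ContinuousAt, hinj.leftInvOn_invFunOn hz]
  intro V hV
  have himg : f '' (V ∩ U) ∈ 𝓝 (f z) := hf.nhds_le_map_nhds_of_injOn hU hinj hz
    (image_mem_map (inter_mem hV (hU.mem_nhds hz)))
  refine mem_map.2 (mem_of_superset himg ?_)
  rintro _ ⟨w, ⟨hwV, hwU⟩, rfl⟩
  rwa [mem_preimage, hinj.leftInvOn_invFunOn hwU]

theorem DifferentiableOn.eventually_deriv_ne_zero_of_injOn (hf : DifferentiableOn ℂ f U)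
    (hU : IsOpen U) (hinj : InjOn f U) {z : ℂ} (hz : z ∈ U) :
    ∀ᶠ w in 𝓝[≠] z, _root_.deriv f w ≠ 0 := by
  refine (hf.analyticAt (hU.mem_nhds hz)).deriv.eventually_eq_zero_or_eventually_ne_zero.resolve_left
    fun h ↦ hinj.not_eventually_const hU hz ?_
  obtain ⟨r, hr, hball⟩ := Metric.eventually_nhds_iff_ball.1 (h.and (hU.mem_nhds hz))
  filter_upwards [ball_mem_nhds z hr] with w hw
  exact isOpen_ball.is_const_of_deriv_eq_zero (convex_ball z r).isPreconnected
    (hf.mono fun x hx ↦ (hball x hx).2) (fun x hx ↦ (hball x hx).1) hw (mem_ball_self hr)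

/-- The inverse of an injective holomorphic function is holomorphic. -/
theorem DifferentiableOn.differentiableOn_invFunOn (hf : DifferentiableOn ℂ f U) (hU : IsOpen U)
    (hinj : InjOn f U) : DifferentiableOn ℂ (Function.invFunOn f U) (f '' U) := by
  rintro _ ⟨z, hz, rfl⟩
  have hcont := hf.continuousAt_invFunOn hU hinj hz
  refine (Complex.analyticAt_of_differentiable_on_punctured_nhds_of_continuousAt ?_
    hcont).differentiableAt.differentiableWithinAt
  have hΩ := hf.isOpen_image_of_injOn hU hinj
  have hev := eventually_nhdsWithin_iff.1 (hf.eventually_deriv_ne_zero_of_injOn hU hinj hz)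
  rw [ContinuousAt, hinj.leftInvOn_invFunOn hz] at hcont
  rw [eventually_nhdsWithin_iff]
  filter_upwards [hcont.eventually hev, hΩ.mem_nhds (mem_image_of_mem f hz)]
  rintro _ hne ⟨w, hw, rfl⟩ hwz
  rw [hinj.leftInvOn_invFunOn hw] at hne
  have hd : HasDerivAt f (_root_.deriv f w) (Function.invFunOn f U (f w)) := by
    rw [hinj.leftInvOn_invFunOn hw]
    exact (hf.differentiableAt (hU.mem_nhds hw)).hasDerivAt
  refine (hd.of_local_left_inverse (hf.continuousAt_invFunOn hU hinj hw)
    (hne fun h ↦ hwz (congrArg f h)) ?_).differentiableAt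
  filter_upwards [hΩ.mem_nhds (mem_image_of_mem f hw)] with y hy
  exact Function.invFunOn_eq hy

end InjectiveHolomorphic

/-- A nonvanishing holomorphic function on a disc has a holomorphic logarithm. -/
theorem DifferentiableOn.exists_exp_eq_of_ball {h : ℂ → ℂ} {c : ℂ} {r : ℝ} {l : ℂ}
    (hh : DifferentiableOn ℂ h (ball c r)) (h0 : ∀ z ∈ ball c r, h z ≠ 0)
    (hl : Complex.exp l = h c) :
    ∃ L : ℂ → ℂ, DifferentiableOn ℂ L (ball c r) ∧ L c = l ∧
      ∀ z ∈ ball c r, Complex.exp (L z) = h z := by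
  obtain ⟨L, hLc, hL⟩ := ((hh.deriv isOpen_ball).div hh h0).isExactOn_ball.with_val_at c l
  have hLd : DifferentiableOn ℂ L (ball c r) :=
    fun z hz ↦ (hL z hz).differentiableAt.differentiableWithinAt
  refine ⟨L, hLd, hLc, fun z hz ↦ ?_⟩
  have hderiv : ∀ w ∈ ball c r, HasDerivAt (fun w ↦ h w * Complex.exp (-L w)) 0 w := by
    intro w hw
    have h1 := (hh.differentiableAt (isOpen_ball.mem_nhds hw)).hasDerivAt
    refine (h1.mul (hL w hw).neg.cexp).congr_deriv ?_
    have := h0 w hw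
    simp only [Pi.div_apply, Pi.neg_apply]
    field_simp
    ring
  have hconst := isOpen_ball.is_const_of_deriv_eq_zero (convex_ball c r).isPreconnected
    (fun w hw ↦ (hderiv w hw).differentiableAt.differentiableWithinAt)
    (fun w hw ↦ (hderiv w hw).deriv) hz (mem_ball_self (pos_of_mem_ball hz))
  simp only [hLc, ← hl, ← Complex.exp_add, add_neg_cancel, Complex.exp_zero] at hconst
  rw [Complex.exp_neg, mul_inv_eq_one₀ (Complex.exp_ne_zero _)] at hconst
  exact hconst.symm

section Growth

variable {f : ℂ → ℂ}

/-- If an injective holomorphic function on the unit disc vanishes at the origin and its image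
contains the disc of radius `R` about the origin, then `R * ‖a‖ ≤ ‖f a‖`. -/
theorem mul_norm_le_norm_of_ball_subset_image (hf : DifferentiableOn ℂ f (ball 0 1))
    (hinj : InjOn f (ball 0 1)) (h0 : f 0 = 0) {R : ℝ} (hR : ball 0 R ⊆ f '' ball 0 1) {a : ℂ}
    (ha : a ∈ ball (0 : ℂ) 1) : R * ‖a‖ ≤ ‖f a‖ := by
  have ha1 : ‖a‖ < 1 := by simpa using ha
  rcases le_or_gt R ‖f a‖ with h | h
  · nlinarith [norm_nonneg a, norm_nonneg (f a)]
  have hRpos : 0 < R := (norm_nonneg _).trans_lt h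
  set g := Function.invFunOn f (ball 0 1)
  have hg0 : g 0 = 0 := by
    simpa [h0] using hinj.leftInvOn_invFunOn (mem_ball_self (x := (0 : ℂ)) one_pos)
  have hga : g (f a) = a := hinj.leftInvOn_invFunOn ha
  have hmaps : MapsTo g (ball 0 R) (closedBall (g 0) 1) := fun w hw ↦ by
    rw [hg0]
    exact ball_subset_closedBall (Function.invFunOn_mem (hR hw))
  have := Complex.dist_le_div_mul_dist_of_mapsTo_ball
    ((hf.differentiableOn_invFunOn isOpen_ball hinj).mono hR) hmaps
    (mem_ball_zero_iff.2 h : f a ∈ ball 0 R)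
  change dist (g (f a)) (g 0) ≤ _ at this
  rw [hga, hg0, dist_zero_right, dist_zero_right, one_div, inv_mul_eq_div,
    le_div_iff₀ hRpos] at this
  linarith

/-- An injective holomorphic function on the unit disc that vanishes at the origin omits a value
of least modulus. -/
theorem exists_notMem_image_ball_subset_image (hf : DifferentiableOn ℂ f (ball 0 1))
    (hinj : InjOn f (ball 0 1)) (h0 : f 0 = 0) :
    ∃ c ∉ f '' ball 0 1, ball 0 ‖c‖ ⊆ f '' ball 0 1 := by
  have hne : (f '' ball 0 1)ᶜ.Nonempty := by
    rw [nonempty_compl]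
    intro huniv
    have ha : (1 / 2 : ℂ) ∈ ball (0 : ℂ) 1 := by norm_num
    have := mul_norm_le_norm_of_ball_subset_image hf hinj h0
      (R := 2 * ‖f (1 / 2)‖ + 1) (huniv ▸ subset_univ _) ha
    norm_num at this
    linarith
  obtain ⟨c, hc, hdist⟩ :=
    (hf.isOpen_image_of_injOn isOpen_ball hinj).isClosed_compl.exists_infDist_eq_dist hne 0
  refine ⟨c, hc, fun w hw ↦ ?_⟩
  by_contra hw'
  have := infDist_le_dist_of_mem (x := (0 : ℂ)) (mem_compl hw')
  rw [hdist, dist_zero_left, dist_zero_left] at this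
  exact (mem_ball_zero_iff.1 hw).not_ge this

/-- The branch of `√(1 - f / c)` that is `1` at the origin stays in the right half-plane on the
preimage of the disc of radius `‖c‖`, if that disc lies in the image of `f`. -/
theorem re_pos_of_sq_eq_one_sub_div (hf : DifferentiableOn ℂ f (ball 0 1))
    (hinj : InjOn f (ball 0 1)) (h0 : f 0 = 0) {c : ℂ} (hcball : ball 0 ‖c‖ ⊆ f '' ball 0 1)
    {u : ℂ → ℂ} (hu : ContinuousOn u (ball 0 1)) (hu0 : u 0 = 1)
    (husq : ∀ z ∈ ball (0 : ℂ) 1, u z ^ 2 = 1 - f z / c) {z : ℂ} (hz : z ∈ ball (0 : ℂ) 1)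
    (hfz : ‖f z‖ < ‖c‖) : 0 < (u z).re := by
  set g := Function.invFunOn f (ball 0 1)
  have hcpos : 0 < ‖c‖ := (norm_nonneg _).trans_lt hfz
  have hg : ContinuousOn g (ball 0 ‖c‖) :=
    (hf.differentiableOn_invFunOn isOpen_ball hinj).continuousOn.mono hcball
  have hgmem : MapsTo g (ball 0 ‖c‖) (ball 0 1) := fun w hw ↦ Function.invFunOn_mem (hcball hw)
  have hg0 : g 0 = 0 := by
    simpa [h0] using hinj.leftInvOn_invFunOn (mem_ball_self (x := (0 : ℂ)) one_pos)
  have hcont : ContinuousOn (fun w ↦ (u (g w)).re) (ball 0 ‖c‖) :=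
    Complex.continuous_re.comp_continuousOn (hu.comp hg hgmem)
  have hnz : ∀ w ∈ ball 0 ‖c‖, (u (g w)).re ≠ 0 := by
    intro w hw hre
    have hsq := husq _ (hgmem hw)
    rw [Function.invFunOn_eq (hcball hw)] at hsq
    have h1 : (w / c).re < 1 := (Complex.re_le_norm _).trans_lt <| by
      rw [norm_div, div_lt_one hcpos]
      exact mem_ball_zero_iff.1 hw
    have h2 := congrArg Complex.re hsq
    rw [pow_two, Complex.mul_re, hre, Complex.sub_re, Complex.one_re] at h2
    nlinarith [mul_self_nonneg (u (g w)).im]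
  by_contra hneg
  have hpre := (convex_ball (0 : ℂ) ‖c‖).isPreconnected.image _ hcont
  have hz' : (u z).re ∈ (fun w ↦ (u (g w)).re) '' ball 0 ‖c‖ :=
    ⟨f z, mem_ball_zero_iff.2 hfz, by simp only [g, hinj.leftInvOn_invFunOn hz]⟩
  have h1 : (1 : ℝ) ∈ (fun w ↦ (u (g w)).re) '' ball 0 ‖c‖ :=
    ⟨0, mem_ball_self hcpos, by simp [hg0, hu0]⟩
  obtain ⟨w, hw, hw0⟩ := hpre.ordConnected.out hz' h1 ⟨not_lt.1 hneg, zero_le_one⟩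
  exact hnz w hw hw0

/-- A growth estimate for injective holomorphic functions on the unit disc in terms of the value
at one point. -/
theorem norm_le_of_injOn_ball (hf : DifferentiableOn ℂ f (ball 0 1))
    (hinj : InjOn f (ball 0 1)) (h0 : f 0 = 0) {a : ℂ} (ha : a ∈ ball (0 : ℂ) 1) (ha0 : a ≠ 0)
    {z : ℂ} (hz : z ∈ ball (0 : ℂ) 1) :
    ‖f z‖ ≤ ‖f a‖ / ‖a‖ *
      (1 + (2 * Real.exp (2 * Real.log 8 * ‖z‖ / (1 - ‖z‖)) + 1) ^ 2) := by
  obtain ⟨c, hc, hcball⟩ := exists_notMem_image_ball_subset_image hf hinj h0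
  have h0mem : (0 : ℂ) ∈ ball (0 : ℂ) 1 := mem_ball_self one_pos
  have hc0 : c ≠ 0 := by
    rintro rfl
    exact hc ⟨0, h0mem, h0⟩
  have hcpos : 0 < ‖c‖ := norm_pos_iff.2 hc0
  obtain ⟨L, hL, hL0, hLexp⟩ := DifferentiableOn.exists_exp_eq_of_ball (l := 0)
    (h := fun z ↦ 1 - f z / c) ((differentiableOn_const 1).sub (hf.div_const c))
    (fun z hz h ↦ hc ⟨z, hz, by field_simp at h; linear_combination -h⟩) (by simp [h0])
  set u : ℂ → ℂ := fun z ↦ Complex.exp (L z / 2) with hudef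
  have hu : DifferentiableOn ℂ u (ball 0 1) := (hL.div_const 2).cexp
  have hu0 : u 0 = 1 := by simp [hudef, hL0]
  have husq : ∀ z ∈ ball (0 : ℂ) 1, u z ^ 2 = 1 - f z / c := fun z hz ↦ by
    rw [← hLexp z hz, hudef, ← Complex.exp_nat_mul]
    congr 1
    push_cast
    ring
  have hfu : ∀ z ∈ ball (0 : ℂ) 1, f z = c * (1 - u z ^ 2) := fun z hz ↦ by
    rw [husq z hz]
    field_simp
    ring
  have hlow : ∀ z ∈ ball (0 : ℂ) 1, 1 / 4 ≤ ‖1 + u z‖ := by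
    intro z hz
    by_contra! hlt
    have hre : (u z).re < 0 := by
      have := (Complex.re_le_norm (1 + u z)).trans_lt hlt
      rw [Complex.add_re, Complex.one_re] at this
      linarith
    refine hre.not_gt (re_pos_of_sq_eq_one_sub_div hf hinj h0 hcball hu.continuousOn hu0 husq hz ?_)
    rw [hfu z hz, norm_mul, show 1 - u z ^ 2 = (1 + u z) * (2 - (1 + u z)) by ring, norm_mul]
    have : ‖2 - (1 + u z)‖ ≤ 2 + ‖1 + u z‖ := (norm_sub_le _ _).trans (by norm_num)
    have : ‖1 + u z‖ * ‖2 - (1 + u z)‖ < 1 := by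
      nlinarith [norm_nonneg (1 + u z), norm_nonneg (2 - (1 + u z))]
    nlinarith
  obtain ⟨G, hG, hG0, hGexp⟩ := DifferentiableOn.exists_exp_eq_of_ball (l := 0)
    (h := fun z ↦ (1 + u z) / 2) (((differentiableOn_const 1).add hu).div_const 2)
    (fun z hz h ↦ by
      have := hlow z hz
      rw [(div_eq_zero_iff.1 h).resolve_right two_ne_zero, norm_zero] at this
      norm_num at this) (by norm_num [hu0])
  have hGre : MapsTo (fun z ↦ -G z) (ball 0 1) {z | z.re ≤ Real.log 8} := by
    intro z hz
    have h1 := congrArg norm (hGexp z hz)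
    rw [Complex.norm_exp, norm_div, Complex.norm_ofNat] at h1
    have h2 : Real.exp (-Real.log 8) ≤ Real.exp (G z).re := by
      rw [Real.exp_neg, Real.exp_log (by norm_num), h1]
      linarith [hlow z hz]
    rw [mem_ofPred_eq, Complex.neg_re]
    linarith [Real.exp_le_exp.1 h2]
  have hGle := Complex.borelCaratheodory_zero (Real.log_pos (by norm_num)) hG.neg hGre one_pos hz
    (by simp [hG0])
  rw [Pi.neg_apply, norm_neg] at hGle
  have hule : ‖u z‖ ≤ 2 * Real.exp (2 * Real.log 8 * ‖z‖ / (1 - ‖z‖)) + 1 := by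
    have h1 : u z = 2 * Complex.exp (G z) - 1 := by
      rw [hGexp z hz]
      ring
    have h2 : ‖Complex.exp (G z)‖ ≤ Real.exp (2 * Real.log 8 * ‖z‖ / (1 - ‖z‖)) := by
      rw [Complex.norm_exp]
      exact Real.exp_le_exp.2 ((Complex.re_le_norm _).trans hGle)
    rw [h1]
    refine (norm_sub_le _ _).trans ?_
    rw [norm_mul, Complex.norm_ofNat, norm_one]
    linarith
  rw [hfu z hz, norm_mul]
  have hca : ‖c‖ ≤ ‖f a‖ / ‖a‖ := by
    rw [le_div_iff₀ (norm_pos_iff.2 ha0)]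
    exact mul_norm_le_norm_of_ball_subset_image hf hinj h0 hcball ha
  have h1u : ‖1 - u z ^ 2‖ ≤ 1 + ‖u z‖ ^ 2 := (norm_sub_le _ _).trans (by simp)
  gcongr
  exact h1u.trans (by gcongr)

end Growth

/-- **Montel's theorem**: a sequence of holomorphic functions on an open set that is uniformly
bounded on compact subsets has a locally uniformly convergent subsequence. -/
theorem exists_subseq_tendstoLocallyUniformlyOn_of_bounded {U : Set ℂ} (hU : IsOpen U)
    {F : ℕ → ℂ → ℂ} (hF : ∀ k, DifferentiableOn ℂ (F k) U)
    (hbd : ∀ K ⊆ U, IsCompact K → ∃ M, ∀ k, ∀ z ∈ K, ‖F k z‖ ≤ M) :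
    ∃ (φ : ℕ → ℕ) (g : ℂ → ℂ), StrictMono φ ∧ DifferentiableOn ℂ g U ∧
      TendstoLocallyUniformlyOn (fun k ↦ F (φ k)) g atTop U := by
  have : LocallyCompactSpace U := hU.locallyCompactSpace
  let A : ℕ → C(U, ℂ) := fun k ↦ ⟨U.domRestrict (F k), (hF k).continuousOn.domRestrict⟩
  have hequi : Equicontinuous fun k ↦ (A k : U → ℂ) := by
    rintro ⟨x, hx⟩
    obtain ⟨r, hr, hrU⟩ := nhds_basis_closedBall.mem_iff.1 (hU.mem_nhds hx)
    obtain ⟨M, hM⟩ := hbd _ hrU (isCompact_closedBall x r)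
    refine Metric.equicontinuousAt_of_continuity_modulus
      (fun y : U ↦ (2 * M) / r * dist (y : ℂ) x) ?_ _ ?_
    · have : Continuous fun y : U ↦ (2 * M) / r * dist (y : ℂ) x := by fun_prop
      simpa using this.tendsto ⟨x, hx⟩
    · filter_upwards [continuous_subtype_val.continuousAt.preimage_mem_nhds (ball_mem_nhds x hr)]
        with y hy k
      rw [dist_comm]
      refine Complex.dist_le_div_mul_dist_of_mapsTo_ball
        ((hF k).mono (ball_subset_closedBall.trans hrU)) (fun w hw ↦ ?_) hy
      rw [mem_closedBall, dist_eq_norm]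
      have := hM k w (ball_subset_closedBall hw)
      have := hM k x (mem_closedBall_self hr.le)
      linarith [norm_sub_le (F k w) (F k x)]
  have hcompact : IsCompact (closure (range A)) := by
    have : T2Space (UniformOnFun U ℂ {K | IsCompact K}) :=
      UniformOnFun.t2Space_of_covering sUnion_isCompact_eq_univ
    refine ArzelaAscoli.isCompact_closure_of_isClosedEmbedding (𝔖 := {K : Set U | IsCompact K})
      (F := fun h : C(U, ℂ) ↦ (h : U → ℂ)) (fun _ ↦ id)
      ContinuousMap.isUniformEmbedding_toUniformOnFunIsCompact.isClosedEmbedding ?_ ?_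
    · refine fun K _ ↦ Equicontinuous.equicontinuousOn (fun x V hV ↦ ?_) K
      filter_upwards [hequi x V hV]
      rintro y hy ⟨_, k, rfl⟩
      exact hy k
    · rintro - - ⟨x, hx⟩ -
      obtain ⟨M, hM⟩ := hbd {x} (singleton_subset_iff.2 hx) isCompact_singleton
      refine ⟨closedBall 0 M, isCompact_closedBall 0 M, ?_⟩
      rintro _ ⟨k, rfl⟩
      exact mem_closedBall_zero_iff.2 (hM k x rfl)
  obtain ⟨G, -, φ, hφ, hlim⟩ :=
    hcompact.isSeqCompact (x := A) fun k ↦ subset_closure (mem_range_self k)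
  have hg : TendstoLocallyUniformlyOn (fun k ↦ F (φ k)) (Function.extend Subtype.val G 0)
      atTop U := by
    rw [tendstoLocallyUniformlyOn_iff_tendstoLocallyUniformly_comp_coe,
      Function.extend_comp Subtype.val_injective]
    exact ContinuousMap.tendsto_iff_tendstoLocallyUniformly.1 hlim
  exact ⟨φ, _, hφ, hg.differentiableOn (.of_forall fun k ↦ hF (φ k)) hU, hg⟩

/-- The family of injective holomorphic functions `f` on the unit disc with `f 0 = 0` and
`f a = b` is a normal family: every sequence has a subsequence converging locally uniformly
on the disc to a holomorphic function. -/
theorem stmt_3 (a b : ℂ) (ha : a ≠ 0) (hb : b ≠ 0) (ha1 : ‖a‖ < 1)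
    (f : ℕ → ℂ → ℂ)
    (hf : ∀ k, DifferentiableOn ℂ (f k) (ball (0 : ℂ) 1) ∧
      Set.InjOn (f k) (ball (0 : ℂ) 1) ∧ f k 0 = 0 ∧ f k a = b) :
    ∃ (φ : ℕ → ℕ) (g : ℂ → ℂ), StrictMono φ ∧ DifferentiableOn ℂ g (ball (0 : ℂ) 1) ∧
      TendstoLocallyUniformlyOn (fun k => f (φ k)) g Filter.atTop (ball (0 : ℂ) 1) := by
  refine exists_subseq_tendstoLocallyUniformlyOn_of_bounded isOpen_ball (fun k ↦ (hf k).1)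
    fun K hK hKc ↦ ?_
  let B : ℂ → ℝ := fun z ↦ ‖b‖ / ‖a‖ *
    (1 + (2 * Real.exp (2 * Real.log 8 * ‖z‖ / (1 - ‖z‖)) + 1) ^ 2)
  have hB : ContinuousOn B K := by
    have : ∀ z ∈ K, 1 - ‖z‖ ≠ 0 := fun z hz ↦ (sub_pos.2 (mem_ball_zero_iff.1 (hK hz))).ne'
    fun_prop (disch := assumption)
  obtain ⟨M, hM⟩ := hKc.bddAbove_image hB
  refine ⟨M, fun k z hz ↦ le_trans ?_ (hM (mem_image_of_mem B hz))⟩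
  obtain ⟨hd, hinj, h0, hab⟩ := hf k
  have := norm_le_of_injOn_ball hd hinj h0 (mem_ball_zero_iff.2 ha1) ha (hK hz)
  rwa [hab] at this
end

section
/- Let f : D → ℂ be an injective holomorphic function on the open unit disc with f(0) = 0. Then for every z ∈ D with r = |z|, one has |f'(0)|·r/(1+r)² ≤ |f(z)| ≤ |f'(0)|·r/(1−r)². -/
open Metric Set

open MeasureTheory in
theorem setIntegral_annulus_eq_integral_circleAverage {g : ℂ → ℂ} {a b : ℝ} (ha : 0 < a)
    (hg : ContinuousOn g {z | ‖z‖ ∈ Icc a b}) :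
    ∫ z in {z : ℂ | ‖z‖ ∈ Ioo a b}, g z =
      ∫ r in Ioo a b, (2 * Real.pi * r) • Real.circleAverage g 0 r := by
  have hA : MeasurableSet {z : ℂ | ‖z‖ ∈ Ioo a b} := measurable_norm measurableSet_Ioo
  have hpol : ∀ p : ℝ × ℝ, Complex.polarCoord.symm p = circleMap 0 p.1 p.2 := fun p ↦ by
    simp [circleMap, Complex.exp_mul_I]
  have hI : IntegrableOn (fun p : ℝ × ℝ ↦ p.1 • g (Complex.polarCoord.symm p))
      (Ioo a b ×ˢ Ioo (-Real.pi) Real.pi) := by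
    refine IntegrableOn.mono_set (t := Icc a b ×ˢ Icc (-Real.pi) Real.pi) ?_
      (prod_mono Ioo_subset_Icc_self Ioo_subset_Icc_self)
    refine ContinuousOn.integrableOn_compact (isCompact_Icc.prod isCompact_Icc) ?_
    refine continuousOn_fst.smul (hg.comp ?_ ?_)
    · rw [show (⇑Complex.polarCoord.symm : ℝ × ℝ → ℂ) = fun p ↦ circleMap 0 p.1 p.2 from funext hpol]
      exact Continuous.continuousOn (by fun_prop)
    · rintro p ⟨hp, -⟩
      simpa [hpol, abs_of_pos (ha.trans_le hp.1)] using hp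
  rw [Measure.volume_eq_prod] at hI
  rw [← integral_indicator hA, ← Complex.integral_comp_polarCoord_symm]
  have : ∀ p ∈ polarCoord.target, p.1 • ({z : ℂ | ‖z‖ ∈ Ioo a b}.indicator g
      (Complex.polarCoord.symm p)) = (Ioo a b ×ˢ Ioo (-Real.pi) Real.pi).indicator
      (fun p ↦ p.1 • g (Complex.polarCoord.symm p)) p := by
    rintro p ⟨hp1, hp2⟩
    have hp1 : 0 < p.1 := hp1
    by_cases h : p.1 ∈ Ioo a b
    · rw [indicator_of_mem, indicator_of_mem]
      · exact ⟨h, hp2⟩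
      · simpa [hpol, abs_of_pos hp1] using h
    · rw [indicator_of_notMem, indicator_of_notMem, smul_zero]
      · exact fun h' ↦ h h'.1
      · simpa [hpol, abs_of_pos hp1] using h
  have hsub : Ioo a b ×ˢ Ioo (-Real.pi) Real.pi ⊆ polarCoord.target :=
    prod_mono (fun x hx ↦ ha.trans hx.1) subset_rfl
  rw [setIntegral_congr_fun polarCoord.open_target.measurableSet this,
    setIntegral_indicator (measurableSet_Ioo.prod measurableSet_Ioo),
    inter_eq_right.2 hsub,
    Measure.volume_eq_prod, setIntegral_prod _ hI]
  refine setIntegral_congr_fun measurableSet_Ioo fun r hr ↦ ?_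
  simp only [hpol]
  rw [Real.circleAverage_eq_integral_add (-Real.pi),
    intervalIntegral.integral_comp_add_right (fun θ ↦ g (circleMap 0 r θ)), integral_smul,
    intervalIntegral.integral_of_le (by linarith [Real.pi_pos]), integral_Ioc_eq_integral_Ioo,
    smul_smul]
  have : 2 * Real.pi + -Real.pi = Real.pi := by ring
  rw [this, zero_add]
  congr 1
  field_simp

theorem det_id_sub_smul_conj (b : ℂ) :
    LinearMap.det (LinearMap.id - b • (Complex.conjAe.toLinearMap) : ℂ →ₗ[ℝ] ℂ) = 1 - ‖b‖ ^ 2 := by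
  rw [← LinearMap.det_toMatrix Complex.basisOneI, Matrix.det_fin_two]
  simp [LinearMap.toMatrix_apply, Complex.sq_norm, Complex.normSq_apply]
  ring

theorem det_restrictScalars_toSpanSingleton (b : ℂ) :
    ((ContinuousLinearMap.toSpanSingleton ℂ b).restrictScalars ℝ).det = ‖b‖ ^ 2 := by
  simp [ContinuousLinearMap.det, LinearMap.det_restrictScalars, Algebra.norm_complex_apply,
    Complex.sq_norm]

open MeasureTheory in
theorem volume_image_eq_integral_norm_deriv_sq {f : ℂ → ℂ} {s : Set ℂ} (hs : MeasurableSet s)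
    (hf : ∀ z ∈ s, DifferentiableAt ℂ f z) (hi : InjOn f s) :
    volume.real (f '' s) = ∫ z in s, ‖deriv f z‖ ^ 2 := by
  have := integral_image_eq_integral_abs_det_fderiv_smul volume hs
    (fun z hz ↦ ((hf z hz).hasDerivAt.hasFDerivAt.restrictScalars ℝ).hasFDerivWithinAt) hi
    (fun _ ↦ (1 : ℝ))
  simpa [det_restrictScalars_toSpanSingleton] using this

theorem isCompact_annulus (a b : ℝ) : IsCompact {z : ℂ | ‖z‖ ∈ Icc a b} := by
  refine (isCompact_closedBall (0 : ℂ) b).of_isClosed_subset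
    (isClosed_Icc.preimage continuous_norm) fun z hz ↦ ?_
  simpa using hz.2

open MeasureTheory in
theorem le_volume_image_annulus {H : ℂ → ℂ} (hH : DifferentiableOn ℂ H (ball 0 1))
    (hi : InjOn (fun z ↦ z⁻¹ + H z) (ball 0 1 \ {0})) {a b : ℝ} (ha : 0 < a) (hab : a < b)
    (hb : b < 1) :
    Real.pi * ((a ^ 2)⁻¹ - (b ^ 2)⁻¹ + ‖deriv H 0‖ ^ 2 * (b ^ 2 - a ^ 2)) ≤
      volume.real ((fun z ↦ z⁻¹ + H z) '' {z | ‖z‖ ∈ Ioo a b}) := by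
  set A := {z : ℂ | ‖z‖ ∈ Ioo a b} with hA_def
  set B := {z : ℂ | ‖z‖ ∈ Icc a b} with hB_def
  have hA : MeasurableSet A := measurable_norm measurableSet_Ioo
  have hAB : A ⊆ B := fun z hz ↦ Ioo_subset_Icc_self hz
  have hB0 : ∀ z ∈ B, z ≠ 0 := fun z hz ↦ norm_pos_iff.1 (ha.trans_le hz.1)
  have hB1 : ∀ z ∈ B, z ∈ ball (0 : ℂ) 1 := fun z hz ↦ by simpa using hz.2.trans_lt hb
  have hHd : ∀ z ∈ B, HasDerivAt H (deriv H z) z := fun z hz ↦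
    (hH.differentiableAt (isOpen_ball.mem_nhds (hB1 z hz))).hasDerivAt
  have hKd : ∀ z ∈ B, HasDerivAt (fun z ↦ z⁻¹ + H z) (-(z ^ 2)⁻¹ + deriv H z) z := fun z hz ↦
    (hasDerivAt_inv (hB0 z hz)).add (hHd z hz)
  have hH' : DifferentiableOn ℂ (deriv H) (ball 0 1) := hH.deriv isOpen_ball
  have hH'B : ContinuousOn (deriv H) B := hH'.continuousOn.mono hB1
  set β := deriv H 0 with hβ
  set g : ℂ → ℂ := fun z ↦ ((‖z‖ : ℂ) ^ 4)⁻¹ - 2 * (z ^ 2 * deriv H z) * ((‖z‖ : ℂ) ^ 4)⁻¹ +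
    2 * (starRingEnd ℂ β * deriv H z) - (‖β‖ : ℂ) ^ 2 with hg_def
  have hgc : ContinuousOn g B := by
    have h4 : ContinuousOn (fun z : ℂ ↦ ((‖z‖ : ℂ) ^ 4)⁻¹) B :=
      ContinuousOn.inv₀ (by fun_prop) fun z hz ↦ by simpa using hB0 z hz
    fun_prop
  have hcomp : IsCompact B := isCompact_annulus a b
  have hgi : IntegrableOn g A := (hgc.integrableOn_compact hcomp).mono_set hAB
  have hpt : ∀ z ∈ A, (g z).re ≤ ‖deriv (fun z ↦ z⁻¹ + H z) z‖ ^ 2 := by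
    intro z hz
    have hz0 : z ≠ 0 := hB0 z (hAB hz)
    rw [(hKd z (hAB hz)).deriv]
    set w := deriv H z
    have hn : (‖z‖ : ℂ) ^ 4 = z ^ 2 * (starRingEnd ℂ z) ^ 2 := by
      rw [← mul_pow, Complex.mul_conj, Complex.normSq_eq_norm_sq]; push_cast; ring
    have h1 : (‖-(z ^ 2)⁻¹ + w‖ : ℝ) ^ 2 =
        (((‖z‖ : ℂ) ^ 4)⁻¹ - 2 * (z ^ 2 * w) * ((‖z‖ : ℂ) ^ 4)⁻¹).re + ‖w‖ ^ 2 := by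
      have e : 2 * (z ^ 2 * w) * ((‖z‖ : ℂ) ^ 4)⁻¹ = 2 * (w * starRingEnd ℂ ((z ^ 2)⁻¹)) := by
        have : starRingEnd ℂ z ≠ 0 := by simpa using hz0
        rw [hn]; simp only [map_inv₀, map_pow]; field_simp
      have e2 : ((‖z‖ : ℂ) ^ 4)⁻¹ = ((‖(z ^ 2)⁻¹‖ ^ 2 : ℝ) : ℂ) := by
        simp; ring
      rw [e, e2, Complex.sq_norm, Complex.sq_norm, Complex.sq_norm, neg_add_eq_sub,
        Complex.normSq_sub]
      simp only [Complex.sub_re, Complex.ofReal_re, Complex.mul_re, Complex.re_ofNat,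
        Complex.im_ofNat, zero_mul, sub_zero]
      ring
    have h2 : 0 ≤ ‖w - β‖ ^ 2 := by positivity
    rw [Complex.sq_norm, Complex.normSq_sub, ← Complex.sq_norm, ← Complex.sq_norm] at h2
    have h3 : (g z).re = (((‖z‖ : ℂ) ^ 4)⁻¹ - 2 * (z ^ 2 * w) * ((‖z‖ : ℂ) ^ 4)⁻¹).re +
        2 * (w * starRingEnd ℂ β).re - ‖β‖ ^ 2 := by
      have : (‖β‖ : ℂ) ^ 2 = ((‖β‖ ^ 2 : ℝ) : ℂ) := by push_cast; rfl
      have h4 : (2 * (w * starRingEnd ℂ β)).re = 2 * (w * starRingEnd ℂ β).re := by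
        rw [Complex.mul_re, Complex.re_ofNat, Complex.im_ofNat, zero_mul, sub_zero]
      simp only [hg_def]
      rw [this, mul_comm (starRingEnd ℂ β), Complex.sub_re, Complex.add_re, Complex.ofReal_re, h4]
    rw [h1, h3]
    linarith
  have havg : ∀ r ∈ Ioo a b, (2 * Real.pi * r) • Real.circleAverage g 0 r =
      ((2 * Real.pi * ((r ^ 3)⁻¹ + r * ‖β‖ ^ 2) : ℝ) : ℂ) := by
    intro r hr
    have hr0 : 0 < r := ha.trans hr.1
    set F : ℂ → ℂ := fun z ↦ ((r : ℂ) ^ 4)⁻¹ - 2 * (z ^ 2 * deriv H z) * ((r : ℂ) ^ 4)⁻¹ +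
      2 * (starRingEnd ℂ β * deriv H z) - (‖β‖ : ℂ) ^ 2 with hF_def
    have hF : DifferentiableOn ℂ F (ball 0 1) := by fun_prop
    have h1 : Real.circleAverage g 0 r = Real.circleAverage F 0 r := by
      refine Real.circleAverage_congr_sphere fun z hz ↦ ?_
      have : ‖z‖ = r := by simpa [abs_of_pos hr0] using hz
      simp only [hg_def, hF_def, this]
    have h2 : Real.circleAverage F 0 r = F 0 := by
      refine DiffContOnCl.circleAverage (DifferentiableOn.diffContOnCl (hF.mono ?_))
      rw [closure_ball _ (by simpa using hr0.ne'), abs_of_pos hr0]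
      exact closedBall_subset_ball (hr.2.trans hb)
    have h3 : starRingEnd ℂ β * β = (‖β‖ : ℂ) ^ 2 := by
      rw [mul_comm, Complex.mul_conj, Complex.normSq_eq_norm_sq]; push_cast; rfl
    have hr' : (r : ℂ) ≠ 0 := by exact_mod_cast hr0.ne'
    rw [h1, h2]
    simp only [hF_def, ← hβ, h3, Complex.real_smul]
    push_cast
    field_simp
    ring
  have hint : ∫ z in A, g z =
      ((Real.pi * ((a ^ 2)⁻¹ - (b ^ 2)⁻¹ + ‖β‖ ^ 2 * (b ^ 2 - a ^ 2)) : ℝ) : ℂ) := by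
    rw [setIntegral_annulus_eq_integral_circleAverage ha hgc,
      setIntegral_congr_fun measurableSet_Ioo havg, integral_complex_ofReal,
      ← integral_Ioc_eq_integral_Ioo, ← intervalIntegral.integral_of_le hab.le]
    congr 1
    have hpos : ∀ r ∈ uIcc a b, 0 < r := fun r hr ↦ by
      rw [uIcc_of_le hab.le] at hr
      exact ha.trans_le hr.1
    have hd : ∀ r ∈ uIcc a b, HasDerivAt (fun r : ℝ ↦ Real.pi * (‖β‖ ^ 2 * r ^ 2 - (r ^ 2)⁻¹))
        (2 * Real.pi * ((r ^ 3)⁻¹ + r * ‖β‖ ^ 2)) r := by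
      intro r hr
      have hr0 := (hpos r hr).ne'
      convert! (((hasDerivAt_pow 2 r).const_mul (‖β‖ ^ 2)).sub
        ((hasDerivAt_pow 2 r).fun_inv (by positivity))).const_mul Real.pi using 1
      simp
      field_simp
      ring
    rw [intervalIntegral.integral_eq_sub_of_hasDerivAt hd]
    · ring
    · refine ContinuousOn.intervalIntegrable ?_
      have : ContinuousOn (fun r : ℝ ↦ (r ^ 3)⁻¹) (uIcc a b) :=
        ContinuousOn.inv₀ (by fun_prop) fun r hr ↦ pow_ne_zero _ (hpos r hr).ne'
      fun_prop
  have hiA : InjOn (fun z ↦ z⁻¹ + H z) A :=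
    hi.mono (fun z hz ↦ ⟨hB1 z (hAB hz), hB0 z (hAB hz)⟩ : A ⊆ ball 0 1 \ {0})
  rw [volume_image_eq_integral_norm_deriv_sq hA
    (fun z hz ↦ (hKd z (hAB hz)).differentiableAt) hiA]
  calc _ = (∫ z in A, g z).re := by rw [hint, Complex.ofReal_re]
    _ = ∫ z in A, (g z).re := (integral_re hgi).symm
    _ ≤ _ := by
      refine setIntegral_mono_on hgi.re ?_ hA hpt
      refine IntegrableOn.mono_set (ContinuousOn.integrableOn_compact (K := B) hcomp ?_) hAB
      have : ContinuousOn (deriv (fun z ↦ z⁻¹ + H z)) B := by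
        have : ContinuousOn (fun z : ℂ ↦ -(z ^ 2)⁻¹ + deriv H z) B := by
          have : ContinuousOn (fun z : ℂ ↦ (z ^ 2)⁻¹) B :=
            ContinuousOn.inv₀ (by fun_prop) fun r hr ↦ pow_ne_zero _ (hB0 r hr)
          fun_prop
        exact this.congr fun z hz ↦ (hKd z hz).deriv
      fun_prop

theorem inv_add_mul_le_of_two_mul_mul_le {a s p C : ℝ} (ha : 0 < a) (has : a < s) (hs : s < 1)
    (hp : 0 ≤ p) (hC : 0 ≤ C) (h : 2 * a * (p + C) ≤ 1) :
    s⁻¹ + p * (s * (1 - a ^ 2 / s ^ 2)) + C * s ^ 2 ≤ a⁻¹ + C * a ^ 2 := by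
  have hs0 : 0 < s := ha.trans has
  have key : a⁻¹ + C * a ^ 2 - (s⁻¹ + p * (s * (1 - a ^ 2 / s ^ 2)) + C * s ^ 2) =
      (s - a) / (a * s) * (1 - a * (s + a) * (p + C * s)) := by
    field_simp
    ring
  have h1 : a * (s + a) * (p + C * s) ≤ a * 2 * (p + C) := by
    gcongr
    · linarith
    · nlinarith
  have h2 : 0 ≤ (s - a) / (a * s) * (1 - a * (s + a) * (p + C * s)) :=
    mul_nonneg (div_nonneg (by linarith) (by positivity)) (by linarith)
  linarith

open MeasureTheory in
theorem exists_volume_image_annulus_le {H : ℂ → ℂ} (hH : DifferentiableOn ℂ H (ball 0 1))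
    (h0 : H 0 = 0) {b : ℝ} (hb : b < 1) :
    ∃ C : ℝ, 0 ≤ C ∧ ∀ a, 0 < a → a < b → 2 * a * (‖deriv H 0‖ + C) ≤ 1 →
      (1 - ‖deriv H 0‖ ^ 2 * a ^ 4) *
        volume.real ((fun z ↦ z⁻¹ + H z) '' {z | ‖z‖ ∈ Ioo a b}) ≤
          Real.pi * (a⁻¹ + C * a ^ 2) ^ 2 := by
  set β := deriv H 0
  have hnhds : ball (0 : ℂ) 1 ∈ nhds 0 := ball_mem_nhds 0 one_pos
  set m := dslope (dslope H 0) 0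
  have hm : DifferentiableOn ℂ m (ball 0 1) :=
    (Complex.differentiableOn_dslope hnhds).2 ((Complex.differentiableOn_dslope hnhds).2 hH)
  have hHm : ∀ z, H z = β * z + z ^ 2 * m z := by
    intro z
    have h1 := sub_smul_dslope H 0 z
    have h2 := sub_smul_dslope (dslope H 0) 0 z
    simp only [sub_zero, h0, smul_eq_mul, dslope_same] at h1 h2
    rw [← h1, pow_two, mul_assoc, h2]
    ring
  obtain ⟨M, hM⟩ := (isCompact_closedBall (0 : ℂ) b).exists_bound_of_continuousOn
    (hm.continuousOn.mono (closedBall_subset_ball hb))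
  have hM' : ∀ z : ℂ, ‖z‖ < b → ‖m z‖ ≤ max M 0 := fun z hz ↦
    (hM z (by simpa using hz.le)).trans (le_max_left _ _)
  have hM0 : 0 ≤ max M 0 := le_max_right _ _
  generalize max M 0 = N at hM' hM0
  refine ⟨N + ‖β‖ * (‖β‖ + N), by positivity, fun a ha hab haC ↦ ?_⟩
  set C := N + ‖β‖ * (‖β‖ + N) with hC_def
  have hC : 0 ≤ C := by positivity
  set T : ℂ →ₗ[ℝ] ℂ := LinearMap.id - (β * (a : ℂ) ^ 2) • (Complex.conjAe.toLinearMap)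
  have hT : ∀ w, T w = w - β * (a : ℂ) ^ 2 * starRingEnd ℂ w := fun w ↦ by simp [T]
  have hdet : LinearMap.det T = 1 - ‖β‖ ^ 2 * a ^ 4 := by
    rw [det_id_sub_smul_conj]
    simp
    ring
  have hsub : T '' ((fun z ↦ z⁻¹ + H z) '' {z | ‖z‖ ∈ Ioo a b}) ⊆
      closedBall 0 (a⁻¹ + C * a ^ 2) := by
    rintro _ ⟨_, ⟨z, ⟨hz1, hz2⟩, rfl⟩, rfl⟩
    have hs0 : 0 < ‖z‖ := ha.trans hz1
    have hz0 : z ≠ 0 := norm_pos_iff.1 hs0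
    rw [mem_closedBall_zero_iff, hT]
    have e : z⁻¹ + H z - β * (a : ℂ) ^ 2 * starRingEnd ℂ (z⁻¹ + H z) =
        z⁻¹ + β * (z * ((1 - a ^ 2 / ‖z‖ ^ 2 : ℝ) : ℂ)) + z ^ 2 * m z -
          β * (a : ℂ) ^ 2 * starRingEnd ℂ (H z) := by
      have h1 : (‖z‖ : ℂ) ^ 2 = z * starRingEnd ℂ z := by
        rw [Complex.mul_conj, Complex.normSq_eq_norm_sq]; push_cast; rfl
      have h2 : starRingEnd ℂ z ≠ 0 := by simpa using hz0
      push_cast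
      rw [h1, map_add, map_inv₀, hHm z]
      generalize starRingEnd ℂ (β * z + z ^ 2 * m z) = u
      field_simp
      ring
    have hHz : ‖H z‖ ≤ (‖β‖ + N) * ‖z‖ := by
      rw [hHm z]
      calc _ ≤ ‖β‖ * ‖z‖ + ‖z‖ ^ 2 * ‖m z‖ := by
            refine (norm_add_le _ _).trans ?_
            simp
        _ ≤ ‖β‖ * ‖z‖ + ‖z‖ * N := by
            gcongr
            · nlinarith
            · exact hM' z hz2
        _ = _ := by ring
    have h1 : 0 ≤ 1 - a ^ 2 / ‖z‖ ^ 2 := by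
      rw [sub_nonneg, div_le_one (by positivity)]
      gcongr
    calc _ ≤ ‖z‖⁻¹ + ‖β‖ * (‖z‖ * (1 - a ^ 2 / ‖z‖ ^ 2)) + ‖z‖ ^ 2 * ‖m z‖ +
          ‖β‖ * a ^ 2 * ‖H z‖ := by
          rw [e]
          refine (norm_sub_le _ _).trans (add_le_add ((norm_add_le _ _).trans
            (add_le_add ((norm_add_le _ _).trans ?_) ?_)) ?_)
          · rw [norm_inv, norm_mul, norm_mul, Complex.norm_real, Real.norm_of_nonneg h1]
          · simp
          · simp
      _ ≤ ‖z‖⁻¹ + ‖β‖ * (‖z‖ * (1 - a ^ 2 / ‖z‖ ^ 2)) + ‖z‖ ^ 2 * N +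
          ‖β‖ * ‖z‖ * ((‖β‖ + N) * ‖z‖) := by
          gcongr
          · exact hM' z hz2
          · nlinarith
      _ = ‖z‖⁻¹ + ‖β‖ * (‖z‖ * (1 - a ^ 2 / ‖z‖ ^ 2)) + C * ‖z‖ ^ 2 := by
          rw [hC_def]; ring
      _ ≤ _ := inv_add_mul_le_of_two_mul_mul_le ha hz1 (hz2.trans hb) (norm_nonneg _) hC haC
  have hR : 0 ≤ a⁻¹ + C * a ^ 2 := by positivity
  calc _ ≤ |LinearMap.det T| *
        volume.real ((fun z ↦ z⁻¹ + H z) '' {z | ‖z‖ ∈ Ioo a b}) := by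
        rw [hdet]
        gcongr
        exact le_abs_self _
    _ = volume.real (T '' ((fun z ↦ z⁻¹ + H z) '' {z | ‖z‖ ∈ Ioo a b})) := by
        rw [Measure.real, Measure.real, Measure.addHaar_image_linearMap, ENNReal.toReal_mul,
          ENNReal.toReal_ofReal (abs_nonneg _)]
    _ ≤ volume.real (closedBall (0 : ℂ) (a⁻¹ + C * a ^ 2)) :=
        measureReal_mono hsub measure_closedBall_lt_top.ne
    _ = _ := by
        rw [Measure.real, Complex.volume_closedBall]
        simp [ENNReal.toReal_ofReal hR, mul_comm]

open Filter Topology in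
/-- **Gronwall's area theorem**, first coefficient: if `z⁻¹ + H z` is injective on the punctured
unit disc, with `H` holomorphic on the disc and `H 0 = 0`, then `‖H' 0‖ ≤ 1`. -/
theorem norm_deriv_le_one_of_injOn_inv_add {H : ℂ → ℂ} (hH : DifferentiableOn ℂ H (ball 0 1))
    (h0 : H 0 = 0) (hi : InjOn (fun z ↦ z⁻¹ + H z) (ball 0 1 \ {0})) :
    ‖deriv H 0‖ ≤ 1 := by
  have key : ∀ b ∈ Ioo (0 : ℝ) 1, ‖deriv H 0‖ * b ^ 2 ≤ 1 := by
    rintro b ⟨hb0, hb⟩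
    obtain ⟨C, hC, hCa⟩ := exists_volume_image_annulus_le hH h0 hb
    generalize hp : ‖deriv H 0‖ = p at hCa
    have hp0 : 0 ≤ p := hp ▸ norm_nonneg _
    have hlim : ∀ {φ : ℝ → ℝ}, Continuous φ → Tendsto φ (𝓝[>] 0) (𝓝 (φ 0)) := fun hφ ↦
      hφ.continuousAt.tendsto.mono_left nhdsWithin_le_nhds
    have h1 : ∀ᶠ a in 𝓝[>] (0 : ℝ), a < b :=
      nhdsWithin_le_nhds (gt_mem_nhds hb0)
    have h2 : ∀ᶠ a in 𝓝[>] (0 : ℝ), 2 * a * (p + C) < 1 :=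
      (hlim (φ := fun a ↦ 2 * a * (p + C)) (by fun_prop)).eventually_lt_const (by simp)
    have h3 : ∀ᶠ a in 𝓝[>] (0 : ℝ), p ^ 2 * a ^ 4 < 1 :=
      (hlim (φ := fun a ↦ p ^ 2 * a ^ 4) (by fun_prop)).eventually_lt_const (by simp)
    have h4 : ∀ᶠ a in 𝓝[>] (0 : ℝ), p ^ 2 * b ^ 2 - (b ^ 2)⁻¹ ≤
        2 * C * a + C ^ 2 * a ^ 4 + 2 * p ^ 2 * a ^ 2 - p ^ 2 * a ^ 4 * (b ^ 2)⁻¹ +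
          p ^ 4 * a ^ 4 * (b ^ 2 - a ^ 2) := by
      filter_upwards [h1, h2, h3, self_mem_nhdsWithin] with a h1 h2 h3 (ha : 0 < a)
      have hl := le_volume_image_annulus hH hi ha h1 hb
      rw [hp] at hl
      have := (mul_le_mul_of_nonneg_left hl (by linarith : 0 ≤ 1 - p ^ 2 * a ^ 4)).trans
        (hCa a ha h1 h2.le)
      rw [mul_left_comm, mul_le_mul_iff_right₀ Real.pi_pos] at this
      have e1 : (1 - p ^ 2 * a ^ 4) * ((a ^ 2)⁻¹ - (b ^ 2)⁻¹ + p ^ 2 * (b ^ 2 - a ^ 2)) =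
          (a ^ 2)⁻¹ - (b ^ 2)⁻¹ + p ^ 2 * b ^ 2 - 2 * p ^ 2 * a ^ 2 + p ^ 2 * a ^ 4 * (b ^ 2)⁻¹ -
            p ^ 4 * a ^ 4 * (b ^ 2 - a ^ 2) := by
        field_simp
        ring
      have e2 : (a⁻¹ + C * a ^ 2) ^ 2 = (a ^ 2)⁻¹ + 2 * C * a + C ^ 2 * a ^ 4 := by
        field_simp
        ring
      rw [e1, e2] at this
      linarith
    have h5 := ge_of_tendsto (hlim (by fun_prop)) h4
    simp only [mul_zero, ne_eq, OfNat.ofNat_ne_zero, not_false_eq_true, zero_pow, zero_mul,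
      add_zero, sub_zero] at h5
    have h6 : (p * b ^ 2) ^ 2 ≤ 1 := by
      have : (p * b ^ 2) ^ 2 - 1 = b ^ 2 * (p ^ 2 * b ^ 2 - (b ^ 2)⁻¹) := by field_simp
      nlinarith [sq_nonneg b]
    exact (sq_le_one_iff₀ (by positivity)).1 h6
  have hlim : Tendsto (fun b : ℝ ↦ ‖deriv H 0‖ * b ^ 2) (𝓝[<] 1) (𝓝 (‖deriv H 0‖ * 1 ^ 2)) :=
    (Continuous.tendsto (by fun_prop) 1).mono_left nhdsWithin_le_nhds
  rw [one_pow, mul_one] at hlim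
  exact le_of_tendsto hlim (mem_of_superset (Ioo_mem_nhdsLT zero_lt_one) key)

theorem DifferentiableOn.exists_sq_eq_of_ne_zero {Q : ℂ → ℂ} (hQ : DifferentiableOn ℂ Q (ball 0 1))
    (hQ0 : ∀ z ∈ ball (0 : ℂ) 1, Q z ≠ 0) (h1 : Q 0 = 1) :
    ∃ S : ℂ → ℂ, DifferentiableOn ℂ S (ball 0 1) ∧ (∀ z ∈ ball (0 : ℂ) 1, S z ^ 2 = Q z) ∧
      S 0 = 1 := by
  obtain ⟨P, hP⟩ := ((hQ.deriv isOpen_ball).div hQ hQ0).isExactOn_ball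
  have hE : ∀ z ∈ ball (0 : ℂ) 1, HasDerivAt (fun w ↦ Q w * Complex.exp (-(P w - P 0))) 0 z := by
    intro z hz
    convert! (hQ.differentiableAt (isOpen_ball.mem_nhds hz)).hasDerivAt.mul
      ((hP z hz).sub_const (P 0)).neg.cexp using 1
    have := hQ0 z hz
    simp only [Pi.div_apply]
    field_simp
    ring
  have hc : ∀ z ∈ ball (0 : ℂ) 1, Q z * Complex.exp (-(P z - P 0)) = 1 := by
    intro z hz
    have := isOpen_ball.is_const_of_deriv_eq_zero (convex_ball (0 : ℂ) 1).isPreconnected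
      (fun w hw ↦ (hE w hw).differentiableAt.differentiableWithinAt)
      (fun w hw ↦ (hE w hw).deriv) hz (mem_ball_self one_pos)
    simpa [h1] using this
  refine ⟨fun z ↦ Complex.exp ((P z - P 0) / 2), fun z hz ↦ ?_, fun z hz ↦ ?_, by simp⟩
  · exact (((hP z hz).sub_const (P 0)).div_const 2).cexp.differentiableAt.differentiableWithinAt
  · rw [← Complex.exp_nat_mul]
    have h := hc z hz
    rw [Complex.exp_neg] at h
    have := Complex.exp_ne_zero (P z - P 0)
    field_simp at h
    rw [h]
    congr 1
    push_cast
    ring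

/-- A meromorphic function `z⁻¹ + h z` that is injective and does not vanish on the punctured unit
disc has constant coefficient of norm at most `2`. -/
theorem norm_le_two_of_injOn_inv_add {h : ℂ → ℂ} (hh : DifferentiableOn ℂ h (ball 0 1))
    (hi : InjOn (fun z ↦ z⁻¹ + h z) (ball 0 1 \ {0}))
    (hne : ∀ z ∈ ball (0 : ℂ) 1 \ {0}, z⁻¹ + h z ≠ 0) : ‖h 0‖ ≤ 2 := by
  have hnhds : ball (0 : ℂ) 1 ∈ nhds 0 := ball_mem_nhds 0 one_pos
  obtain ⟨S, hS, hSQ, hS0⟩ := DifferentiableOn.exists_sq_eq_of_ne_zero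
    (Q := fun z ↦ 1 + z * h z) (by fun_prop) (fun z hz ↦ by
      rcases eq_or_ne z 0 with rfl | hz0
      · simp
      · have : 1 + z * h z = z * (z⁻¹ + h z) := by field_simp
        rw [this]
        exact mul_ne_zero hz0 (hne z ⟨hz, hz0⟩)) (by simp)
  set t := dslope S 0
  have ht : DifferentiableOn ℂ t (ball 0 1) := (Complex.differentiableOn_dslope hnhds).2 hS
  have hSt : ∀ z, S z = 1 + z * t z := fun z ↦ by
    have := sub_smul_dslope S 0 z
    rw [sub_zero, hS0, smul_eq_mul] at this
    rw [this]; ring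
  have hsq : MapsTo (fun z : ℂ ↦ z ^ 2) (ball 0 1) (ball 0 1) := fun z hz ↦ by
    rw [mem_ball_zero_iff] at hz ⊢
    rw [norm_pow]
    exact pow_lt_one₀ (norm_nonneg _) hz two_ne_zero
  have ht2 : DifferentiableOn ℂ (fun z ↦ t (z ^ 2)) (ball 0 1) :=
    ht.comp (by fun_prop) hsq
  have hK : ∀ z ∈ ball (0 : ℂ) 1 \ {0},
      (z⁻¹ + z * t (z ^ 2)) ^ 2 = (z ^ 2)⁻¹ + h (z ^ 2) := by
    rintro z ⟨hz, hz0⟩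
    have hz0 : z ≠ 0 := hz0
    have h1 : z⁻¹ + z * t (z ^ 2) = z⁻¹ * S (z ^ 2) := by
      rw [hSt]; field_simp
    rw [h1, mul_pow, hSQ _ (hsq hz)]
    field_simp
  have hsq0 : ∀ z ∈ ball (0 : ℂ) 1 \ {0}, z ^ 2 ∈ ball (0 : ℂ) 1 \ {0} := fun z hz ↦
    ⟨hsq hz.1, pow_ne_zero 2 hz.2⟩
  have hinj : InjOn (fun z ↦ z⁻¹ + z * t (z ^ 2)) (ball 0 1 \ {0}) := by
    intro z hz w hw hzw
    simp only at hzw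
    have h1 : z ^ 2 = w ^ 2 := hi (hsq0 z hz) (hsq0 w hw) (by
      simp only
      rw [← hK z hz, ← hK w hw, hzw])
    rcases sq_eq_sq_iff_eq_or_eq_neg.1 h1 with h2 | h2
    · exact h2
    · exfalso
      refine hne _ (hsq0 w hw) ?_
      rw [← hK w hw]
      rw [h1, h2, inv_neg] at hzw
      have : w⁻¹ + w * t (w ^ 2) = 0 := by linear_combination -hzw / 2
      rw [this]; simp
  have hd : deriv (fun z ↦ z * t (z ^ 2)) 0 = t 0 := by
    have := (hasDerivAt_id' (0 : ℂ)).fun_mul (ht2.differentiableAt hnhds).hasDerivAt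
    simpa using this.deriv
  have hmain := norm_deriv_le_one_of_injOn_inv_add (H := fun z ↦ z * t (z ^ 2))
    (by fun_prop) (by simp) hinj
  rw [hd] at hmain
  have hth : h 0 = 2 * t 0 := by
    have hSd := (hS.differentiableAt hnhds).hasDerivAt
    have h1 : HasDerivAt (fun z ↦ S z ^ 2) (2 * t 0) 0 := by
      convert! hSd.pow 2 using 1
      simp [t, hS0]
    have h2 : HasDerivAt (fun z ↦ 1 + z * h z) (h 0) 0 := by
      convert! ((hasDerivAt_id (0 : ℂ)).mul (hh.differentiableAt hnhds).hasDerivAt).const_add 1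
        using 1
      simp
    exact h2.unique (h1.congr_of_eventuallyEq
      (Filter.eventually_of_mem hnhds fun z hz ↦ (hSQ z hz).symm))
  rw [hth, norm_mul, Complex.norm_ofNat]
  linarith

/-- **Koebe one-quarter theorem**: a value omitted by a univalent function on the unit disc
vanishing at the origin has norm at least `‖g' 0‖ / 4`. -/
theorem norm_deriv_le_four_mul_norm_of_notMem_image {g : ℂ → ℂ}
    (hg : DifferentiableOn ℂ g (ball 0 1)) (hi : InjOn g (ball 0 1)) (h0 : g 0 = 0) {w : ℂ}
    (hw : ∀ z ∈ ball (0 : ℂ) 1, g z ≠ w) : ‖deriv g 0‖ ≤ 4 * ‖w‖ := by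
  have hnhds : ball (0 : ℂ) 1 ∈ nhds 0 := ball_mem_nhds 0 one_pos
  have h0m : (0 : ℂ) ∈ ball (0 : ℂ) 1 := mem_ball_self one_pos
  rcases eq_or_ne (deriv g 0) 0 with hd | hd
  · simp [hd]
  have hw0 : w ≠ 0 := fun h ↦ hw 0 h0m (by rw [h0, h])
  have hg0 : ∀ z ∈ ball (0 : ℂ) 1 \ {0}, g z ≠ 0 := fun z hz h ↦
    hz.2 (hi hz.1 h0m (by rw [h, h0]))
  set p := deriv g 0
  set d := dslope g 0
  have hdd : DifferentiableOn ℂ d (ball 0 1) := (Complex.differentiableOn_dslope hnhds).2 hg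
  have hgd : ∀ z, g z = z * d z := fun z ↦ by
    simpa [h0] using (sub_smul_dslope g 0 z).symm
  have hd0 : ∀ z ∈ ball (0 : ℂ) 1, d z ≠ 0 := by
    intro z hz
    rcases eq_or_ne z 0 with rfl | hz0
    · simpa [d] using hd
    · exact right_ne_zero_of_mul (hgd z ▸ hg0 z ⟨hz, hz0⟩)
  have hed : DifferentiableOn ℂ (fun z ↦ p / d z) (ball 0 1) := by fun_prop (disch := assumption)
  set h := dslope (fun z ↦ p / d z) 0
  have hhd : DifferentiableOn ℂ h (ball 0 1) := (Complex.differentiableOn_dslope hnhds).2 hed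
  have hh : ∀ z ∈ ball (0 : ℂ) 1 \ {0}, z⁻¹ + h z = p / g z := by
    rintro z ⟨hz, hz0⟩
    have hz0 : z ≠ 0 := hz0
    have h1 := sub_smul_dslope (fun z ↦ p / d z) 0 z
    have h2 : p / d 0 = 1 := by simp [d, p, div_self hd]
    have h3 := hd0 z hz
    simp only [sub_zero, h2, smul_eq_mul] at h1
    have h4 : h z = (p / d z - 1) / z := by rw [eq_div_iff hz0, ← h1]; ring
    rw [h4, hgd z]
    field_simp
    ring
  have hinj : InjOn (fun z ↦ z⁻¹ + h z) (ball 0 1 \ {0}) := by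
    intro z hz z' hz' hzz
    simp only [hh z hz, hh z' hz'] at hzz
    rw [div_eq_mul_inv, div_eq_mul_inv] at hzz
    exact hi hz.1 hz'.1 (inv_injective (mul_left_cancel₀ hd hzz))
  have h1 : ‖h 0‖ ≤ 2 := norm_le_two_of_injOn_inv_add hhd hinj fun z hz ↦ by
    rw [hh z hz]; exact div_ne_zero hd (hg0 z hz)
  have h2 : ‖h 0 - p / w‖ ≤ 2 :=
    norm_le_two_of_injOn_inv_add (h := fun z ↦ h z - p / w) (by fun_prop)
      (fun z hz z' hz' hzz ↦ hinj hz hz' (by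
        simp only [← add_sub_assoc] at hzz
        exact sub_left_injective hzz)) fun z hz ↦ by
        rw [← add_sub_assoc, hh z hz, sub_ne_zero, div_eq_mul_inv, div_eq_mul_inv]
        exact fun h ↦ hw z hz.1 (inv_injective (mul_left_cancel₀ hd h))
  have h3 : ‖p / w‖ ≤ 4 := by
    calc _ = ‖h 0 - (h 0 - p / w)‖ := by rw [sub_sub_cancel]
      _ ≤ _ := (norm_sub_le _ _).trans (by linarith)
  rwa [norm_div, div_le_iff₀ (norm_pos_iff.2 hw0)] at h3

theorem re_one_add_div_one_sub_pos {z : ℂ} (hz : z ∈ ball (0 : ℂ) 1) :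
    0 < ((1 + z) / (1 - z)).re := by
  have hz1 : ‖z‖ < 1 := by simpa using hz
  have hne : 1 - z ≠ 0 := fun h ↦ by
    rw [← sub_eq_zero.1 h] at hz1
    simp at hz1
  have h1 : Complex.normSq z < 1 := by
    rw [Complex.normSq_eq_norm_sq]
    exact pow_lt_one₀ (norm_nonneg _) hz1 two_ne_zero
  have h2 : 0 < Complex.normSq (1 - z) := Complex.normSq_pos.2 hne
  rw [Complex.normSq_apply] at h1
  rw [Complex.div_re, ← add_div]
  refine div_pos ?_ h2
  simp
  nlinarith

theorem norm_sub_one_div_add_one_lt_one {w : ℂ} (hw : 0 < w.re) : ‖(w - 1) / (w + 1)‖ < 1 := by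
  have h0 : w + 1 ≠ 0 := fun h ↦ by
    have := congrArg Complex.re h
    simp at this
    linarith
  rw [norm_div, div_lt_one (norm_pos_iff.2 h0), ← sq_lt_sq₀ (norm_nonneg _) (norm_nonneg _),
    Complex.sq_norm, Complex.sq_norm, Complex.normSq_apply, Complex.normSq_apply]
  simp
  nlinarith

theorem add_mul_sq_mem_slitPlane {s : ℂ} (hs : 0 < s.re) {c : ℝ} (hc0 : 0 < c) (hc1 : c < 1) :
    1 - (c : ℂ) + c * s ^ 2 ∈ Complex.slitPlane := by
  rw [Complex.mem_slitPlane_iff]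
  by_cases him : s.im = 0
  · left
    simp [pow_two, him]
    nlinarith [mul_pos hs hs]
  · right
    simp [pow_two]
    exact ⟨hc0.ne', by rw [mul_comm s.im, ← two_mul]; simp [hs.ne', him]⟩

/-- **Pick's function**: a univalent self-map of the unit disc fixing the origin and omitting
`-r`, with derivative `4 r / (1 + r) ^ 2` at the origin. -/
theorem exists_univalent_selfMap_ne_neg {r : ℝ} (hr0 : 0 < r) (hr1 : r < 1) :
    ∃ φ : ℂ → ℂ, MapsTo φ (ball 0 1) (ball 0 1) ∧ InjOn φ (ball 0 1) ∧
      DifferentiableOn ℂ φ (ball 0 1) ∧ φ 0 = 0 ∧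
      HasDerivAt φ (4 * r / (1 + r) ^ 2 : ℝ) 0 ∧ ∀ z ∈ ball (0 : ℂ) 1, φ z ≠ -r := by
  set c : ℝ := 4 * r / (1 + r) ^ 2 with hc
  have hc0 : 0 < c := by positivity
  have hc1' : 1 - c = ((1 - r) / (1 + r)) ^ 2 := by rw [hc]; field_simp; ring
  have hc1 : c < 1 := by
    have : 0 < 1 - r := by linarith
    have : 0 < ((1 - r) / (1 + r)) ^ 2 := by positivity
    linarith
  have hcC : (c : ℂ) ≠ 0 := by exact_mod_cast hc0.ne'
  set s : ℂ → ℂ := fun z ↦ (1 + z) / (1 - z) with hs_def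
  set σ : ℂ → ℂ := fun z ↦ (1 - (c : ℂ) + c * s z ^ 2).sqrt with hσ_def
  have hs : ∀ z ∈ ball (0 : ℂ) 1, 0 < (s z).re := fun z hz ↦ re_one_add_div_one_sub_pos hz
  have hne : ∀ z ∈ ball (0 : ℂ) 1, 1 - z ≠ 0 := fun z hz h ↦ by
    rw [mem_ball_zero_iff, ← sub_eq_zero.1 h] at hz
    simp at hz
  have hslit : ∀ z ∈ ball (0 : ℂ) 1, 1 - (c : ℂ) + c * s z ^ 2 ∈ Complex.slitPlane :=
    fun z hz ↦ add_mul_sq_mem_slitPlane (hs z hz) hc0 hc1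
  have hσ2 : ∀ z, σ z ^ 2 = 1 - (c : ℂ) + c * s z ^ 2 := fun z ↦ by
    simp only [hσ_def, Complex.sqrt]
    exact_mod_cast Complex.cpow_nat_inv_pow _ two_ne_zero
  have hσ : ∀ z ∈ ball (0 : ℂ) 1, 0 < (σ z).re := fun z hz ↦ by
    simp only [hσ_def, Complex.sqrt, Complex.cpow_inv_two_re]
    refine Real.sqrt_pos.2 (half_pos ?_)
    have h1 := Complex.mem_slitPlane_iff.1 (hslit z hz)
    rcases h1 with h1 | h1
    · positivity
    · linarith [neg_lt_of_abs_lt (Complex.abs_re_lt_norm.2 h1)]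
  have hσ1 : ∀ z ∈ ball (0 : ℂ) 1, σ z + 1 ≠ 0 := fun z hz h ↦ by
    have h1 := congrArg Complex.re h
    have h2 := hσ z hz
    simp at h1
    linarith
  have h0m : (0 : ℂ) ∈ ball (0 : ℂ) 1 := mem_ball_self one_pos
  have hs0 : s 0 = 1 := by simp [hs_def]
  have hσ0 : σ 0 = 1 := by simp [hσ_def, hs0]
  have hsd : ∀ z ∈ ball (0 : ℂ) 1, HasDerivAt s (2 / (1 - z) ^ 2) z := fun z hz ↦ by
    convert! ((hasDerivAt_id' z).const_add 1).fun_div ((hasDerivAt_id' z).const_sub 1) (hne z hz)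
      using 1
    ring
  have hud : ∀ z ∈ ball (0 : ℂ) 1,
      HasDerivAt (fun z ↦ 1 - (c : ℂ) + c * s z ^ 2) (c * (2 * s z * (2 / (1 - z) ^ 2))) z :=
    fun z hz ↦ by simpa using (((hsd z hz).fun_pow 2).const_mul (c : ℂ)).const_add (1 - (c : ℂ))
  have hσd := fun z hz ↦ (Complex.hasDerivAt_sqrt (hslit z hz)).comp z (hud z hz)
  have hφd := fun z hz ↦ ((hσd z hz).sub_const 1).fun_div ((hσd z hz).add_const 1) (hσ1 z hz)
  have hlin : ∀ {v w : ℂ}, v + 1 ≠ 0 → w + 1 ≠ 0 → (v - 1) / (v + 1) = (w - 1) / (w + 1) →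
      v = w := fun hv hw h ↦ by
    rw [div_eq_div_iff hv hw] at h
    linear_combination h / 2
  have hsq : ∀ {v w : ℂ}, 0 < v.re → 0 < w.re → v ^ 2 = w ^ 2 → v = w := fun {v w} hv hw h ↦ by
    rcases sq_eq_sq_iff_eq_or_eq_neg.1 h with h | h
    · exact h
    · rw [h, Complex.neg_re] at hv
      linarith
  refine ⟨fun z ↦ (σ z - 1) / (σ z + 1), fun z hz ↦ ?_, fun z hz w hw h ↦ ?_,
    fun z hz ↦ (hφd z hz).differentiableAt.differentiableWithinAt, by simp [hσ0], ?_,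
    fun z hz h ↦ ?_⟩
  · rw [mem_ball_zero_iff]
    exact norm_sub_one_div_add_one_lt_one (hσ z hz)
  · have h1 := congrArg (· ^ 2) (hlin (hσ1 z hz) (hσ1 w hw) h)
    simp only [hσ2, add_right_inj, mul_right_inj' hcC] at h1
    have h2 := hsq (hs z hz) (hs w hw) h1
    simp only [hs_def] at h2
    rw [div_eq_div_iff (hne z hz) (hne w hw)] at h2
    linear_combination h2 / 2
  · convert! hφd 0 h0m using 1
    simp [hs0]
    ring
  · have hr : (1 : ℂ) + r ≠ 0 := by exact_mod_cast (by linarith : 1 + r ≠ 0)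
    have h1 : σ z = (1 - r) / (1 + r) := by
      rw [div_eq_iff (hσ1 z hz)] at h
      rw [eq_div_iff hr]
      linear_combination h
    have h2 := hσ2 z
    have h3 : 1 - (c : ℂ) = ((1 - r) / (1 + r)) ^ 2 := by
      exact_mod_cast congrArg Complex.ofReal hc1'
    rw [h1, h3, left_eq_add, mul_eq_zero, or_iff_right hcC, pow_eq_zero_iff two_ne_zero] at h2
    have h4 := hs z hz
    rw [h2] at h4
    simp at h4

theorem le_norm_of_univalent {f : ℂ → ℂ} (hf : DifferentiableOn ℂ f (ball 0 1))
    (hi : InjOn f (ball 0 1)) (h0 : f 0 = 0) {z : ℂ} (hz : z ∈ ball (0 : ℂ) 1) :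
    ‖deriv f 0‖ * ‖z‖ / (1 + ‖z‖) ^ 2 ≤ ‖f z‖ := by
  rcases eq_or_ne z 0 with rfl | hz0
  · simp
  have hr0 : 0 < ‖z‖ := norm_pos_iff.2 hz0
  have hr1 : ‖z‖ < 1 := by simpa using hz
  have hrC : (‖z‖ : ℂ) ≠ 0 := by exact_mod_cast hr0.ne'
  obtain ⟨φ, hmaps, hinj, hφ, hφ0, hφd, hφr⟩ := exists_univalent_selfMap_ne_neg hr0 hr1
  set u : ℂ := -z / ‖z‖ with hu
  have hu1 : ‖u‖ = 1 := by simp [hu, hr0.ne']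
  have hu0 : u ≠ 0 := norm_pos_iff.1 (by rw [hu1]; exact one_pos)
  have hmaps' : MapsTo (fun w ↦ u * φ w) (ball 0 1) (ball 0 1) := fun w hw ↦ by
    have := hmaps hw
    rw [mem_ball_zero_iff] at this ⊢
    rwa [norm_mul, hu1, one_mul]
  have hd : HasDerivAt (fun w ↦ f (u * φ w))
      (deriv f 0 * (u * (4 * ‖z‖ / (1 + ‖z‖) ^ 2 : ℝ))) 0 := by
    have hf0 : HasDerivAt f (deriv f 0) (u * φ 0) := by
      rw [hφ0, mul_zero]
      exact (hf.differentiableAt (ball_mem_nhds 0 one_pos)).hasDerivAt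
    exact hf0.comp (0 : ℂ) (hφd.const_mul u)
  have key := norm_deriv_le_four_mul_norm_of_notMem_image (g := fun w ↦ f (u * φ w)) (w := f z)
    (hf.comp (hφ.const_mul u) hmaps')
    (fun w hw w' hw' h ↦ hinj hw hw' (mul_left_cancel₀ hu0 (hi (hmaps' hw) (hmaps' hw') h)))
    (by simp [hφ0, h0])
    (fun w hw h ↦ hφr w hw (by
      have h1 : u * φ w = z := hi (hmaps' hw) hz h
      have h2 : u * -(‖z‖ : ℂ) = z := by rw [hu]; field_simp
      exact mul_left_cancel₀ hu0 (h1.trans h2.symm)))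
  rw [hd.deriv, norm_mul, norm_mul, hu1, one_mul, Complex.norm_real,
    Real.norm_of_nonneg (by positivity)] at key
  have : ‖deriv f 0‖ * (4 * ‖z‖ / (1 + ‖z‖) ^ 2) =
      4 * (‖deriv f 0‖ * ‖z‖ / (1 + ‖z‖) ^ 2) := by ring
  linarith

theorem mul_norm_deriv_le_of_univalent {f : ℂ → ℂ} (hf : DifferentiableOn ℂ f (ball 0 1))
    (hi : InjOn f (ball 0 1)) (h0 : f 0 = 0) {a : ℂ} (ha : a ∈ ball (0 : ℂ) 1) :
    ‖a‖ * (1 - ‖a‖) * ‖deriv f a‖ ≤ (1 + ‖a‖) * ‖f a‖ := by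
  have ha1 : ‖a‖ < 1 := by simpa using ha
  have hden : ∀ w ∈ ball (0 : ℂ) 1, 1 + starRingEnd ℂ a * w ≠ 0 := fun w hw h ↦ by
    have h1 : ‖starRingEnd ℂ a * w‖ < 1 := by
      rw [mem_ball_zero_iff] at hw
      rw [norm_mul, Complex.norm_conj]
      nlinarith [norm_nonneg a, norm_nonneg w]
    rw [← neg_eq_iff_add_eq_zero.2 h] at h1
    simp at h1
  set τ : ℂ → ℂ := fun w ↦ (w + a) / (1 + starRingEnd ℂ a * w) with hτ_def
  have hτd : ∀ w ∈ ball (0 : ℂ) 1, HasDerivAt τ ((1 * (1 + starRingEnd ℂ a * w) -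
      (w + a) * (starRingEnd ℂ a * 1)) / (1 + starRingEnd ℂ a * w) ^ 2) w := fun w hw ↦
    ((hasDerivAt_id' w).add_const a).fun_div
      (((hasDerivAt_id' w).const_mul (starRingEnd ℂ a)).const_add 1) (hden w hw)
  have hτm : MapsTo τ (ball 0 1) (ball 0 1) := fun w hw ↦ by
    have h1 := hden w hw
    rw [mem_ball_zero_iff] at hw ⊢
    rw [norm_div, div_lt_one (norm_pos_iff.2 h1), ← sq_lt_sq₀ (norm_nonneg _) (norm_nonneg _)]
    have hw2 : ‖w‖ ^ 2 < 1 := pow_lt_one₀ (norm_nonneg _) hw two_ne_zero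
    have ha2 : ‖a‖ ^ 2 < 1 := pow_lt_one₀ (norm_nonneg _) ha1 two_ne_zero
    have : ‖1 + starRingEnd ℂ a * w‖ ^ 2 - ‖w + a‖ ^ 2 = (1 - ‖a‖ ^ 2) * (1 - ‖w‖ ^ 2) := by
      simp only [Complex.sq_norm, Complex.normSq_apply]
      simp
      ring
    nlinarith
  have hdet : 1 - starRingEnd ℂ a * a ≠ 0 := by
    simpa [sub_eq_add_neg] using hden (-a) (by simpa using ha)
  have hτi : InjOn τ (ball 0 1) := fun w hw w' hw' h ↦ by
    simp only [hτ_def] at h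
    rw [div_eq_div_iff (hden w hw) (hden w' hw')] at h
    refine mul_right_cancel₀ hdet ?_
    linear_combination h
  have hτ0 : τ 0 = a := by simp [hτ_def]
  have hd : HasDerivAt (fun w ↦ f (τ w) - f a) (deriv f a * (1 - ‖a‖ ^ 2 : ℝ)) 0 := by
    have hfa : HasDerivAt f (deriv f a) (τ 0) := by
      rw [hτ0]
      exact (hf.differentiableAt (isOpen_ball.mem_nhds ha)).hasDerivAt
    convert! (hfa.comp (0 : ℂ) (hτd 0 (mem_ball_self one_pos))).sub_const (f a) using 2
    simp [Complex.mul_conj, Complex.normSq_eq_norm_sq]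
  have hτa : τ (-a) = 0 := by simp [hτ_def]
  have key := le_norm_of_univalent (f := fun w ↦ f (τ w) - f a) (z := -a)
    ((hf.comp (fun w hw ↦ (hτd w hw).differentiableAt.differentiableWithinAt) hτm).sub_const _)
    (fun w hw w' hw' h ↦ hτi hw hw' (hi (hτm hw) (hτm hw') (sub_left_injective h)))
    (by simp [hτ0]) (by simpa using ha)
  have h2 : 0 ≤ 1 - ‖a‖ ^ 2 := by nlinarith [norm_nonneg a]
  rw [hd.deriv, hτa, h0, zero_sub, norm_neg, norm_neg, norm_mul, Complex.norm_real,
    Real.norm_of_nonneg h2] at key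
  have hpos : 0 < 1 + ‖a‖ := by positivity
  calc _ = (1 + ‖a‖) * (‖deriv f a‖ * (1 - ‖a‖ ^ 2) * ‖a‖ / (1 + ‖a‖) ^ 2) := by
        field_simp
        ring
    _ ≤ _ := by gcongr

theorem norm_le_of_univalent {f : ℂ → ℂ} (hf : DifferentiableOn ℂ f (ball 0 1))
    (hi : InjOn f (ball 0 1)) (h0 : f 0 = 0) {z : ℂ} (hz : z ∈ ball (0 : ℂ) 1) :
    ‖f z‖ ≤ ‖deriv f 0‖ * ‖z‖ / (1 - ‖z‖) ^ 2 := by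
  rcases eq_or_ne z 0 with rfl | hz0
  · simp [h0]
  have hr0 : 0 < ‖z‖ := norm_pos_iff.2 hz0
  have hr1 : ‖z‖ < 1 := by simpa using hz
  have hrC : (‖z‖ : ℂ) ≠ 0 := by exact_mod_cast hr0.ne'
  set u : ℂ := z / ‖z‖ with hu
  have hu1 : ‖u‖ = 1 := by simp [hu, hr0.ne']
  have hru : (‖z‖ : ℂ) * u = z := by rw [hu]; field_simp
  set d := dslope f 0
  have hd : DifferentiableOn ℂ d (ball 0 1) :=
    (Complex.differentiableOn_dslope (ball_mem_nhds 0 one_pos)).2 hf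
  have hfd : ∀ w, f w = w * d w := fun w ↦ by
    simpa [h0] using (sub_smul_dslope f 0 w).symm
  have hmem : ∀ t ∈ Icc 0 ‖z‖, (t : ℂ) * u ∈ ball (0 : ℂ) 1 := fun t ht ↦ by
    rw [mem_ball_zero_iff, norm_mul, hu1, mul_one, Complex.norm_real, Real.norm_of_nonneg ht.1]
    exact ht.2.trans_lt hr1
  have hdd : ∀ t ∈ Icc 0 ‖z‖, HasDerivAt (fun t : ℝ ↦ d (t * u)) (u * deriv d (t * u)) t := by
    intro t ht
    have h1 := (hd.differentiableAt (isOpen_ball.mem_nhds (hmem t ht))).hasDerivAt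
    have h2 : HasDerivAt (fun t : ℝ ↦ (t : ℂ) * u) u t := by
      simpa using (Complex.ofRealCLM.hasDerivAt (x := t)).mul_const u
    rw [mul_comm]
    exact h1.comp t h2
  have hψ := fun t ht ↦ ((hdd t ht).norm_sq).mul (((hasDerivAt_id' t).const_sub 1).fun_pow 4)
  have hanti : AntitoneOn ((fun t : ℝ ↦ ‖d (t * u)‖ ^ 2) * fun t ↦ (1 - t) ^ 4) (Icc 0 ‖z‖) := by
    refine antitoneOn_of_deriv_nonpos (convex_Icc _ _)
      (fun t ht ↦ (hψ t ht).continuousAt.continuousWithinAt)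
      (fun t ht ↦ (hψ t (interior_subset ht)).differentiableAt.differentiableWithinAt)
      fun t ht ↦ ?_
    have htI := interior_subset ht
    rw [interior_Icc] at ht
    rw [(hψ t htI).deriv]
    have ht0 : 0 < t := ht.1
    have ht1 : 0 < 1 - t := by linarith [ht.2]
    have hm := hmem t htI
    have hn : ‖(t : ℂ) * u‖ = t := by
      rw [norm_mul, hu1, mul_one, Complex.norm_real, Real.norm_of_nonneg ht0.le]
    have h1 := mul_norm_deriv_le_of_univalent hf hi h0 hm
    rw [hn, hfd, norm_mul, hn] at h1
    have h2 : deriv f (t * u) = d (t * u) + t • (u * deriv d (t * u)) := by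
      have h3 := (hasDerivAt_id' ((t : ℂ) * u)).fun_mul
        (hd.differentiableAt (isOpen_ball.mem_nhds hm)).hasDerivAt
      rw [show f = fun w ↦ w * d w from funext hfd, h3.deriv, Complex.real_smul]
      ring
    set v := d (t * u)
    set e := u * deriv d (t * u)
    have h3 : ‖v‖ ^ 2 + t * inner ℝ v e ≤ ‖v‖ * ‖deriv f (t * u)‖ := by
      refine le_trans (le_of_eq ?_) (real_inner_le_norm _ _)
      rw [h2, inner_add_right, inner_smul_right, real_inner_self_eq_norm_sq]
    have h4 : (1 - t) * ‖deriv f (t * u)‖ ≤ (1 + t) * ‖v‖ := by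
      refine le_of_mul_le_mul_left ?_ ht0
      linarith
    have h5 : (1 - t) * inner ℝ v e ≤ 2 * ‖v‖ ^ 2 := by
      refine le_of_mul_le_mul_left ?_ ht0
      nlinarith [mul_le_mul_of_nonneg_left h3 ht1.le,
        mul_le_mul_of_nonneg_left h4 (norm_nonneg v)]
    have h6 : 0 ≤ (1 - t) ^ 3 := by positivity
    calc _ = 2 * ((1 - t) ^ 3 * ((1 - t) * inner ℝ v e - 2 * ‖v‖ ^ 2)) := by
          push_cast
          ring
      _ ≤ 0 := mul_nonpos_of_nonneg_of_nonpos two_pos.le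
          (mul_nonpos_of_nonneg_of_nonpos h6 (sub_nonpos.2 h5))
  have h1 := hanti (left_mem_Icc.2 hr0.le) (right_mem_Icc.2 hr0.le) hr0.le
  simp only [Pi.mul_apply, hru, Complex.ofReal_zero, zero_mul, sub_zero, one_pow, mul_one] at h1
  have hr1' : 0 < 1 - ‖z‖ := by linarith
  have h2 : ‖d z‖ * (1 - ‖z‖) ^ 2 ≤ ‖deriv f 0‖ := by
    have : d 0 = deriv f 0 := dslope_same f 0
    rw [← this, ← sq_le_sq₀ (by positivity) (norm_nonneg _)]
    linarith
  rw [hfd z, norm_mul, le_div_iff₀ (by positivity)]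
  nlinarith [mul_le_mul_of_nonneg_left h2 hr0.le]

/-- Bieberbach–Gronwall (Koebe) distortion estimates for an injective holomorphic function
on the unit disc vanishing at the origin. -/
theorem stmt_4 (f : ℂ → ℂ)
    (hd : DifferentiableOn ℂ f (ball (0 : ℂ) 1))
    (hi : Set.InjOn f (ball (0 : ℂ) 1))
    (h0 : f 0 = 0) :
    ∀ z ∈ ball (0 : ℂ) 1,
      ‖deriv f 0‖ * ‖z‖ / (1 + ‖z‖) ^ 2 ≤ ‖f z‖ ∧
      ‖f z‖ ≤ ‖deriv f 0‖ * ‖z‖ / (1 - ‖z‖) ^ 2 := by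
  exact fun z hz ↦ ⟨le_norm_of_univalent hd hi h0 hz, norm_le_of_univalent hd hi h0 hz⟩
end
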